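/- Let k ≥ 2 be an integer. If σ ∈ P_{k-2}(ℝ³;𝕊) satisfies div σ = 0 identically on ℝ³, then there exists τ ∈ P_k(ℝ³;𝕊) such that σ = inc τ. Consequently {inc τ : τ ∈ P_k(ℝ³;𝕊)} = {σ ∈ P_{k-2}(ℝ³;𝕊) : div σ = 0}. -/

import Mathlib

open Matrix

noncomputable section

abbrev V3 : Type := Fin 3 → ℝ
abbrev M3 : Type := Matrix (Fin 3) (Fin 3) ℝ

/-- The Levi-Civita symbol `ε i j k` on `Fin 3`. -/
def eps (i j k : Fin 3) : ℝ :=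
  ((((j : ℤ) - (i : ℤ)) * ((k : ℤ) - (j : ℤ)) * ((k : ℤ) - (i : ℤ)) : ℤ) : ℝ) / 2

/-- Partial derivative `∂ᵢ f`. -/
def pd (i : Fin 3) (f : V3 → ℝ) : V3 → ℝ :=
  fun x => fderiv ℝ f x (Pi.single i 1)

/-- Cross product of vectors in `ℝ³`. -/
def vcross (a b : V3) : V3 := fun i => ∑ k, ∑ l, eps i k l * a k * b l

/-- Symmetric part of a matrix, `sym B = (B + Bᵀ)/2`. -/
def symMat (B : M3) : M3 := (2:ℝ)⁻¹ • (B + Bᵀ)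

/-- `(∇v)_{ij} = ∂ᵢ v_j`. -/
def gradv (v : V3 → V3) : V3 → M3 :=
  fun x => Matrix.of fun i j => pd i (fun y => v y j) x

/-- Symmetric gradient (deformation) `def v = (∇v + (∇v)ᵀ)/2`. -/
def defv (v : V3 → V3) : V3 → M3 := fun x => symMat (gradv v x)

/-- Column-wise curl `(∇×A)_{ij} = Σ_{s,t} ε_{ist} ∂_s A_{tj}`. -/
def colCurl (A : V3 → M3) : V3 → M3 :=
  fun x => Matrix.of fun i j => ∑ s, ∑ t, eps i s t * pd s (fun y => A y t j) x

/-- Row-wise curl `(A×∇)_{ij} = Σ_{k,l} ε_{jkl} ∂_l A_{ik}`. -/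
def rowCurl (A : V3 → M3) : V3 → M3 :=
  fun x => Matrix.of fun i j => ∑ k, ∑ l, eps j k l * pd l (fun y => A y i k) x

/-- Incompatibility operator `inc A = ∇×(A×∇)`. -/
def incOp (A : V3 → M3) : V3 → M3 := colCurl (rowCurl A)

/-- Row-wise divergence `(div A)_i = Σ_j ∂_j A_{ij}`. -/
def divRow (A : V3 → M3) : V3 → V3 :=
  fun x i => ∑ j, pd j (fun y => A y i j) x

/-- Curl of a vector field. -/
def curlVec (w : V3 → V3) : V3 → V3 :=
  fun x i => ∑ s, ∑ t, eps i s t * pd s (fun y => w y t) x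

/-- `(b×A)_{ij} = Σ_{k,l} ε_{ikl} b_k A_{lj}`. -/
def bCrossA (b : V3) (A : M3) : M3 :=
  Matrix.of fun i j => ∑ k, ∑ l, eps i k l * b k * A l j

/-- `(A×b)_{ij} = Σ_{k,l} ε_{jkl} A_{ik} b_l`. -/
def aCrossB (A : M3) (b : V3) : M3 :=
  Matrix.of fun i j => ∑ k, ∑ l, eps j k l * A i k * b l

/-- `f : ℝ³ → ℝ` is a polynomial map of total degree at most `m` (`m : ℤ`, so
`m < 0` forces `f = 0` since the zero polynomial has empty support). -/
def PolyDeg (m : ℤ) (f : V3 → ℝ) : Prop :=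
  ∃ p : MvPolynomial (Fin 3) ℝ,
    (∀ d ∈ p.support, ((∑ i, d i : ℕ) : ℤ) ≤ m) ∧ f = fun x => MvPolynomial.eval x p

/-- `P_m(ℝ³;ℝ³)`. -/
def PolyVec (m : ℤ) (v : V3 → V3) : Prop := ∀ i, PolyDeg m fun x => v x i

/-- `P_m(ℝ³;𝕄)`. -/
def PolyMat (m : ℤ) (A : V3 → M3) : Prop := ∀ i j, PolyDeg m fun x => A x i j

/-- `P_m(ℝ³;𝕊)`: polynomial symmetric-matrix-valued maps of degree at most `m`. -/
def PolySym (m : ℤ) (A : V3 → M3) : Prop := PolyMat m A ∧ ∀ x, (A x)ᵀ = A x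

open MvPolynomial

/-- Real polynomials in three variables. -/
abbrev Poly3 : Type := MvPolynomial (Fin 3) ℝ

/-- The polynomial `p` has total degree at most the integer `m`. -/
def DegLE (m : ℤ) (p : Poly3) : Prop := ∀ d ∈ p.support, ((∑ i, d i : ℕ) : ℤ) ≤ m

lemma DegLE.sum {ι : Type*} {m : ℤ} {s : Finset ι} {f : ι → Poly3}
    (h : ∀ a ∈ s, DegLE m (f a)) : DegLE m (∑ a ∈ s, f a) := by
  classical
  intro d hd
  obtain ⟨a, ha, had⟩ := Finset.mem_biUnion.1 (support_sum hd)
  exact h a ha d had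

lemma DegLE.C_mul {m : ℤ} {p : Poly3} (h : DegLE m p) (a : ℝ) : DegLE m (C a * p) := by
  intro d hd
  refine h d ?_
  rw [mem_support_iff, coeff_C_mul] at hd
  exact mem_support_iff.2 (right_ne_zero_of_mul hd)

lemma DegLE.X_mul {m : ℤ} {p : Poly3} (h : DegLE m p) (i : Fin 3) :
    DegLE (m + 1) (X i * p) := by
  intro d hd
  rw [support_X_mul] at hd
  obtain ⟨e, he, rfl⟩ := Finset.mem_map.1 hd
  have := h e he
  simp only [addLeftEmbedding_apply, Finsupp.add_apply, Finset.sum_add_distrib,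
    Finsupp.single_apply, Finset.sum_ite_eq, Finset.mem_univ, if_true]
  push_cast at this ⊢
  linarith

lemma DegLE.pderiv {m : ℤ} {p : Poly3} (h : DegLE m p) (i : Fin 3) :
    DegLE (m - 1) (MvPolynomial.pderiv i p) := by
  intro d hd
  rw [mem_support_iff, coeff_pderiv] at hd
  have := h _ (mem_support_iff.2 (left_ne_zero_of_mul hd))
  simp only [Finsupp.add_apply, Finset.sum_add_distrib,
    Finsupp.single_apply, Finset.sum_ite_eq, Finset.mem_univ, if_true] at this
  push_cast at this ⊢
  linarith

lemma pderiv_comm (i j : Fin 3) (p : Poly3) :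
    pderiv i (pderiv j p) = pderiv j (pderiv i p) := by
  ext d
  simp only [coeff_pderiv, add_right_comm d (Finsupp.single i 1), Finsupp.add_apply]
  rcases eq_or_ne i j with rfl | h
  · rfl
  · simp [h, h.symm]
    ring

lemma hasFDerivAt_eval (p : Poly3) (x : V3) :
    HasFDerivAt (fun y => eval y p)
      (∑ i, eval x (pderiv i p) • ContinuousLinearMap.proj (R := ℝ) (φ := fun _ : Fin 3 => ℝ) i) x := by
  induction p using MvPolynomial.induction_on with
  | C a => simpa using hasFDerivAt_const a x
  | add p q hp hq =>
    simp only [map_add]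
    refine (hp.fun_add hq).congr_fderiv ?_
    simp [add_smul, Finset.sum_add_distrib]
  | mul_X p i hp =>
    simp only [map_mul, eval_X]
    refine (hp.fun_mul (hasFDerivAt_apply i x)).congr_fderiv ?_
    ext y
    simp [Derivation.leibniz, pderiv_X, Pi.single_apply, add_mul, Finset.sum_add_distrib,
      Finset.mul_sum, apply_ite, mul_assoc]

lemma pd_eval (i : Fin 3) (p : Poly3) :
    pd i (fun y => eval y p) = fun y => eval y (pderiv i p) := by
  funext x
  simp [pd, (hasFDerivAt_eval p x).fderiv, Pi.single_apply]

/-- Multiply the degree-`n` homogeneous part of a polynomial by `w n`. -/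
def weight (w : ℕ → ℝ) (p : Poly3) : Poly3 :=
  ∑ d ∈ p.support, monomial d (w (∑ i, d i) * coeff d p)

lemma coeff_weight (w : ℕ → ℝ) (p : Poly3) (d : Fin 3 →₀ ℕ) :
    coeff d (weight w p) = w (∑ i, d i) * coeff d p := by
  classical
  simp only [weight, coeff_sum, coeff_monomial, Finset.sum_ite_eq', mem_support_iff]
  split_ifs with h
  · rfl
  · simp [not_not.1 h]

lemma DegLE.weight {m : ℤ} {p : Poly3} (h : DegLE m p) (w : ℕ → ℝ) :
    DegLE m (weight w p) := by
  intro d hd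
  rw [mem_support_iff, coeff_weight] at hd
  exact h d (mem_support_iff.2 (right_ne_zero_of_mul hd))

lemma pderiv_weight (w : ℕ → ℝ) (i : Fin 3) (p : Poly3) :
    pderiv i (weight w p) = weight (fun n => w (n + 1)) (pderiv i p) := by
  ext d
  simp only [coeff_pderiv, coeff_weight, Finsupp.add_apply, Finset.sum_add_distrib,
    Finsupp.single_apply, Finset.sum_ite_eq, Finset.mem_univ, if_true, mul_assoc]

lemma weight_sum (w : ℕ → ℝ) {ι : Type*} (s : Finset ι) (f : ι → Poly3) :
    weight w (∑ a ∈ s, f a) = ∑ a ∈ s, weight w (f a) := by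
  ext d
  simp only [coeff_weight, coeff_sum, Finset.mul_sum]

lemma weight_zero (w : ℕ → ℝ) : weight w 0 = 0 := by simp [weight]

/-- The Euler operator `x · ∇` shifted by the constant `c`. -/
def euler (c : ℝ) (p : Poly3) : Poly3 := ∑ i, X i * pderiv i p + C c * p

lemma coeff_X_mul_pderiv (i : Fin 3) (p : Poly3) (d : Fin 3 →₀ ℕ) :
    coeff d (X i * pderiv i p) = d i * coeff d p := by
  classical
  rw [coeff_X_mul']
  split_ifs with h
  · have h1 : Finsupp.single i 1 ≤ d := by
      rw [Finsupp.single_le_iff]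
      exact Nat.one_le_iff_ne_zero.2 (Finsupp.mem_support_iff.1 h)
    rw [coeff_pderiv, tsub_add_cancel_of_le h1, mul_comm]
    congr 1
    have h2 := congrArg (fun e : Fin 3 →₀ ℕ => e i) (tsub_add_cancel_of_le h1)
    simp only [Finsupp.add_apply, Finsupp.single_eq_same] at h2
    exact_mod_cast h2
  · simp [Finsupp.notMem_support_iff.1 h]

lemma coeff_euler (c : ℝ) (p : Poly3) (d : Fin 3 →₀ ℕ) :
    coeff d (euler c p) = ((∑ i, d i : ℕ) + c) * coeff d p := by
  simp only [euler, coeff_add, coeff_sum, coeff_X_mul_pderiv, coeff_C_mul]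
  push_cast
  rw [add_mul, Finset.sum_mul]

lemma euler_weight (c : ℝ) (w : ℕ → ℝ) (p : Poly3) :
    euler c (weight w p) = weight (fun n => (n + c) * w n) p := by
  ext d
  simp only [coeff_euler, coeff_weight]
  ring

/-- Matrices of polynomials. -/
abbrev PolyM : Type := Fin 3 → Fin 3 → Poly3

/-- Evaluate a matrix of polynomials. -/
def evalM (P : PolyM) : V3 → M3 := fun x => Matrix.of fun i j => eval x (P i j)

/-- Row-wise curl on polynomial matrices. -/
def rowCurlP (P : PolyM) : PolyM := fun i j => ∑ k, ∑ l, C (eps j k l) * pderiv l (P i k)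

/-- Column-wise curl on polynomial matrices. -/
def colCurlP (P : PolyM) : PolyM := fun i j => ∑ s, ∑ t, C (eps i s t) * pderiv s (P t j)

/-- Row-wise divergence on polynomial matrices. -/
def divP (P : PolyM) : Fin 3 → Poly3 := fun i => ∑ j, pderiv j (P i j)

/-- The product `x × P` acting on columns. -/
def leftX (P : PolyM) : PolyM := fun i j => ∑ a, ∑ b, C (eps i a b) * (X a * P b j)

/-- The cross product of `x` with each row of `P`. -/
def rightX (P : PolyM) : PolyM := fun i j => ∑ a, ∑ b, C (eps j a b) * (X a * P i b)

lemma rowCurl_evalM (P : PolyM) : rowCurl (evalM P) = evalM (rowCurlP P) := by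
  funext x
  ext i j
  simp only [rowCurl, evalM, rowCurlP, Matrix.of_apply, pd_eval, map_sum, map_mul, eval_C]

lemma colCurl_evalM (P : PolyM) : colCurl (evalM P) = evalM (colCurlP P) := by
  funext x
  ext i j
  simp only [colCurl, evalM, colCurlP, Matrix.of_apply, pd_eval, map_sum, map_mul, eval_C]

lemma incOp_evalM (P : PolyM) : incOp (evalM P) = evalM (colCurlP (rowCurlP P)) := by
  rw [incOp, rowCurl_evalM, colCurl_evalM]

lemma divRow_evalM (P : PolyM) (x : V3) (i : Fin 3) :
    divRow (evalM P) x i = eval x (divP P i) := by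
  simp only [divRow, evalM, divP, Matrix.of_apply, pd_eval, map_sum]

lemma divRow_evalM_eq_zero_iff (P : PolyM) :
    (∀ x, divRow (evalM P) x = 0) ↔ ∀ i, divP P i = 0 := by
  constructor
  · intro h i
    refine MvPolynomial.funext fun x => ?_
    rw [← divRow_evalM, h x]
    simp
  · intro h x
    funext i
    rw [divRow_evalM, h i]
    simp

lemma polySym_iff (m : ℤ) (A : V3 → M3) :
    PolySym m A ↔ ∃ P : PolyM, (∀ i j, DegLE m (P i j)) ∧ (∀ i j, P i j = P j i) ∧
      A = evalM P := by
  constructor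
  · rintro ⟨h, hs⟩
    choose P hP hA using h
    have hAP : A = evalM P := by
      funext x
      ext i j
      exact congrFun (hA i j) x
    refine ⟨P, hP, fun i j => ?_, hAP⟩
    refine MvPolynomial.funext fun x => ?_
    have := congrFun (congrFun (hs x) j) i
    rwa [hAP] at this
  · rintro ⟨P, hP, hs, rfl⟩
    refine ⟨fun i j => ⟨P i j, hP i j, rfl⟩, fun x => ?_⟩
    ext i j
    exact congrArg (eval x) (hs j i)

lemma fin3_add : (0 : Fin 3) + 1 = 1 ∧ (0 : Fin 3) + 2 = 2 ∧ (1 : Fin 3) + 1 = 2 ∧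
    (1 : Fin 3) + 2 = 0 ∧ (2 : Fin 3) + 1 = 0 ∧ (2 : Fin 3) + 2 = 1 := by decide

lemma fin3_cases (i : Fin 3) : i = 0 ∨ i = 1 ∨ i = 2 := by
  revert i
  decide

lemma sum_sum_eps (j : Fin 3) (f : Fin 3 → Fin 3 → Poly3) :
    ∑ k, ∑ l, C (eps j k l) * f k l = f (j + 1) (j + 2) - f (j + 2) (j + 1) := by
  have h2 : (C 2 : Poly3) = 2 := map_ofNat C 2
  rcases fin3_cases j with rfl | rfl | rfl <;>
    norm_num [Fin.sum_univ_three, eps, fin3_add, h2] <;> ring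

lemma colCurlP_leftX (Q : PolyM) (hs : ∀ i j, Q i j = Q j i) (hd : ∀ i, divP Q i = 0) :
    colCurlP (leftX Q) = fun i j => -euler 2 (Q i j) := by
  have h2 : (C 2 : Poly3) = 2 := map_ofNat C 2
  funext i j
  have h := hd j
  simp only [divP, hs j, Fin.sum_univ_three] at h
  simp only [colCurlP, leftX, sum_sum_eps, euler]
  rcases fin3_cases i with rfl | rfl | rfl <;>
    simp [fin3_add, Fin.sum_univ_three, pderiv_X, h2]
  · linear_combination X 0 * h
  · linear_combination X 1 * h
  · linear_combination X 2 * h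

lemma rowCurlP_leftX_rightX (Q : PolyM) (hs : ∀ i j, Q i j = Q j i)
    (hd : ∀ i, divP Q i = 0) :
    rowCurlP (leftX (rightX Q)) = leftX fun i j => euler 3 (Q i j) := by
  have h3 : (C 3 : Poly3) = 3 := map_ofNat C 3
  funext i j
  have hd0 := hd 0
  have hd1 := hd 1
  have hd2 := hd 2
  simp only [divP, Fin.sum_univ_three, hs 1 0, hs 2 0, hs 2 1] at hd0 hd1 hd2
  simp only [rowCurlP, leftX, rightX, sum_sum_eps, euler]
  rcases fin3_cases i with rfl | rfl | rfl <;> rcases fin3_cases j with rfl | rfl | rfl <;>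
    simp [fin3_add, Fin.sum_univ_three, pderiv_X, h3,
      hs 1 0, hs 2 0, hs 2 1]
  · linear_combination X 2 * X 0 * hd1 - X 1 * X 0 * hd2
  · linear_combination X 2 * X 1 * hd1 - X 1 * X 1 * hd2
  · linear_combination X 2 * X 2 * hd1 - X 1 * X 2 * hd2
  · linear_combination X 0 * X 0 * hd2 - X 2 * X 0 * hd0
  · linear_combination X 0 * X 1 * hd2 - X 2 * X 1 * hd0
  · linear_combination X 0 * X 2 * hd2 - X 2 * X 2 * hd0
  · linear_combination X 1 * X 0 * hd0 - X 0 * X 0 * hd1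
  · linear_combination X 1 * X 1 * hd0 - X 0 * X 1 * hd1
  · linear_combination X 1 * X 2 * hd0 - X 0 * X 2 * hd1

lemma leftX_rightX_symm {Q : PolyM} (hs : ∀ i j, Q i j = Q j i) (i j : Fin 3) :
    leftX (rightX Q) i j = leftX (rightX Q) j i := by
  simp only [leftX, rightX, sum_sum_eps]
  rw [hs (j + 1) (i + 1), hs (j + 1) (i + 2), hs (j + 2) (i + 1), hs (j + 2) (i + 2)]
  ring

lemma colCurlP_rowCurlP_symm {P : PolyM} (hs : ∀ i j, P i j = P j i) (i j : Fin 3) :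
    colCurlP (rowCurlP P) i j = colCurlP (rowCurlP P) j i := by
  simp only [colCurlP, rowCurlP, sum_sum_eps, map_sub]
  rw [hs (j + 1) (i + 1), hs (j + 1) (i + 2), hs (j + 2) (i + 1), hs (j + 2) (i + 2),
    pderiv_comm (j + 1) (i + 1), pderiv_comm (j + 1) (i + 2),
    pderiv_comm (j + 2) (i + 1), pderiv_comm (j + 2) (i + 2)]
  ring

lemma divP_colCurlP_rowCurlP (P : PolyM) (i : Fin 3) :
    divP (colCurlP (rowCurlP P)) i = 0 := by
  simp only [divP, colCurlP, rowCurlP, sum_sum_eps, map_sub]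
  simp only [Fin.sum_univ_three, fin3_add, pderiv_comm 1 0, pderiv_comm 2 0,
    pderiv_comm 2 1, pderiv_comm _ (i + 1), pderiv_comm _ (i + 2)]
  ring

/-- A divergence-free symmetric polynomial matrix is the incompatibility of a symmetric one, of
degree higher by two. -/
lemma exists_inc_eq {m : ℤ} {Q : PolyM} (hQ : ∀ i j, DegLE m (Q i j))
    (hs : ∀ i j, Q i j = Q j i) (hd : ∀ i, divP Q i = 0) :
    ∃ P : PolyM, (∀ i j, DegLE (m + 2) (P i j)) ∧ (∀ i j, P i j = P j i) ∧
      colCurlP (rowCurlP P) = Q := by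
  have hdw (w : ℕ → ℝ) (i : Fin 3) : divP (fun i j => weight w (Q i j)) i = 0 := by
    have := hd i
    simp only [divP, pderiv_weight, ← weight_sum] at this ⊢
    rw [this, weight_zero]
  let w : ℕ → ℝ := fun n => -(((n : ℝ) + 2) * (n + 3))⁻¹
  let R : PolyM := fun i j => weight w (Q i j)
  have hRs (i j) : R i j = R j i := congrArg (weight w) (hs i j)
  refine ⟨leftX (rightX R), fun i j => ?_, leftX_rightX_symm hRs, ?_⟩
  · rw [show m + 2 = m + 1 + 1 by ring]
    exact DegLE.sum fun a _ => DegLE.sum fun b _ => DegLE.C_mul (DegLE.X_mul (DegLE.sum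
      fun c _ => DegLE.sum fun d _ => DegLE.C_mul (((hQ b d).weight w).X_mul c) _) a) _
  · rw [rowCurlP_leftX_rightX R hRs (hdw w)]
    simp only [R, euler_weight]
    rw [colCurlP_leftX _ (fun i j => by rw [hs i j]) (hdw _)]
    funext i j
    ext d
    simp only [coeff_neg, coeff_euler, coeff_weight, w]
    set n : ℕ := ∑ i, d i
    have h2 : (n : ℝ) + 2 ≠ 0 := by positivity
    have h3 : (n : ℝ) + 3 ≠ 0 := by positivity
    field_simp

/-- for `k ≥ 2`, if `σ ∈ P_{k-2}(ℝ³;𝕊)` and `div σ = 0` then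
`σ = inc τ` for some `τ ∈ P_k(ℝ³;𝕊)`; consequently
`inc P_k(ℝ³;𝕊) = P_{k-2}(ℝ³;𝕊) ∩ ker div`. -/
theorem stmt_3 (k : ℕ) (hk : 2 ≤ k) :
    (∀ σ : V3 → M3, PolySym ((k : ℤ) - 2) σ → (∀ x, divRow σ x = 0) →
      ∃ τ : V3 → M3, PolySym k τ ∧ σ = incOp τ) ∧
    {ρ : V3 → M3 | ∃ τ : V3 → M3, PolySym k τ ∧ ρ = incOp τ}
      = {σ : V3 → M3 | PolySym ((k : ℤ) - 2) σ ∧ ∀ x, divRow σ x = 0} := by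
  have hex : ∀ σ : V3 → M3, PolySym ((k : ℤ) - 2) σ → (∀ x, divRow σ x = 0) →
      ∃ τ : V3 → M3, PolySym k τ ∧ σ = incOp τ := by
    intro σ hσ hdiv
    obtain ⟨Q, hQ, hs, rfl⟩ := (polySym_iff _ _).1 hσ
    obtain ⟨P, hP, hPs, hPQ⟩ := exists_inc_eq hQ hs ((divRow_evalM_eq_zero_iff Q).1 hdiv)
    rw [sub_add_cancel] at hP
    exact ⟨evalM P, (polySym_iff _ _).2 ⟨P, hP, hPs, rfl⟩, by rw [incOp_evalM, hPQ]⟩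
  refine ⟨hex, Set.Subset.antisymm ?_ fun σ hσ => hex σ hσ.1 hσ.2⟩
  rintro _ ⟨τ, hτ, rfl⟩
  obtain ⟨P, hP, hs, rfl⟩ := (polySym_iff _ _).1 hτ
  rw [incOp_evalM]
  refine ⟨(polySym_iff _ _).2 ⟨_, fun i j => ?_, colCurlP_rowCurlP_symm hs, rfl⟩,
    (divRow_evalM_eq_zero_iff _).2 (divP_colCurlP_rowCurlP P)⟩
  rw [show (k : ℤ) - 2 = k - 1 - 1 by ring]
  exact DegLE.sum fun s _ => DegLE.sum fun t _ => DegLE.C_mul (DegLE.pderiv (DegLE.sum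
    fun a _ => DegLE.sum fun b _ => DegLE.C_mul ((hP t a).pderiv b) _) s) _
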